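/- Let α ≥ 1/2 and θ ∈ ℝ. If ε : (0,1) → [0,∞) satisfies ε(γ)/(log(1/(1−γ)))^{1/α} → 0 as γ → 1⁻, then R(θ,γ,S*(θ−ε(γ),γ)) → 0 as γ → 1⁻. -/

import Mathlib

open MeasureTheory Filter Set Topology

/-- Normalization constant `C₀ = (∫ exp(-|x|^α) dx)⁻¹`. -/
noncomputable def C0 (α : ℝ) : ℝ := (∫ x : ℝ, Real.exp (-(|x| ^ α)))⁻¹

/-- Density `f_θ(x) = C₀ exp(-|x-θ|^α)`. -/
noncomputable def fd (α θ x : ℝ) : ℝ := C0 α * Real.exp (-(|x - θ| ^ α))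

/-- Tail probability `P_θ(S) = ∫_S^∞ f_θ(x) dx`. -/
noncomputable def Ptail (α θ S : ℝ) : ℝ := ∫ x in Set.Ioi S, fd α θ x

/-- Conditional mean above `S`: `μ_θ(S) = (∫_S^∞ x f_θ(x) dx) / P_θ(S)`. -/
noncomputable def muTail (α θ S : ℝ) : ℝ := (∫ x in Set.Ioi S, x * fd α θ x) / Ptail α θ S

/-- `g_θ(S) = P_θ(S) / ∫_S^∞ P_θ(x) dx`. -/
noncomputable def gfun (α θ S : ℝ) : ℝ := Ptail α θ S / ∫ x in Set.Ioi S, Ptail α θ x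

/-- Hazard rate `h_θ(S) = f_θ(S)/P_θ(S)`. -/
noncomputable def hazard (α θ S : ℝ) : ℝ := fd α θ S / Ptail α θ S

/-- Value of the threshold policy with threshold `S` under parameter `θ`:
`V_{θ,γ}(S) = μ_θ(S)·P_θ(S)/((1−γ) + γ·P_θ(S))`. -/
noncomputable def Vfun (α θ γ S : ℝ) : ℝ :=
  muTail α θ S * Ptail α θ S / ((1 - γ) + γ * Ptail α θ S)

/-- Critical perturbation magnitude `ε_critical(γ)`. -/
noncomputable def epsCrit (α γ : ℝ) : ℝ :=
  Real.log (Real.log (1/(1-γ))) / (α * (Real.log (1/(1-γ))) ^ (1 - 1/α))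

lemma fd_continuous {α : ℝ} (hα : 0 < α) (θ : ℝ) : Continuous (fd α θ) := by
  unfold fd
  have : Continuous fun x : ℝ => |x - θ| ^ α :=
    (continuous_id.sub continuous_const).abs.rpow_const fun _ => Or.inr hα.le
  fun_prop

lemma integrable_exp_neg_abs_rpow {α : ℝ} (hα : 0 < α) :
    Integrable fun x : ℝ => Real.exp (-(|x| ^ α)) := by
  apply Integrable.of_integral_ne_zero
  rw [integral_comp_abs (f := fun x => Real.exp (-(x ^ α))), integral_exp_neg_rpow hα]
  have := Real.Gamma_pos_of_pos (show 0 < 1 / α + 1 by positivity)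
  positivity

lemma integrable_mul_exp_neg_abs_rpow {α : ℝ} (hα : 0 < α) :
    Integrable fun x : ℝ => x * Real.exp (-(|x| ^ α)) := by
  have key : Integrable fun x : ℝ => |x| ^ (1 : ℝ) * Real.exp (-(|x| ^ α)) := by
    apply Integrable.of_integral_ne_zero
    rw [integral_comp_abs (f := fun x => x ^ (1 : ℝ) * Real.exp (-(x ^ α))),
      integral_rpow_mul_exp_neg_rpow hα (by norm_num)]
    have := Real.Gamma_pos_of_pos (show 0 < (1 + 1) / α by positivity)
    positivity
  have hc : Continuous fun x : ℝ => |x| ^ α :=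
    continuous_abs.rpow_const fun _ => Or.inr hα.le
  refine key.mono (by fun_prop) (ae_of_all _ fun x => ?_)
  simp

lemma C0_pos {α : ℝ} (hα : 0 < α) : 0 < C0 α :=
  inv_pos.2 (integral_exp_pos (integrable_exp_neg_abs_rpow hα))

lemma fd_pos {α : ℝ} (hα : 0 < α) (θ x : ℝ) : 0 < fd α θ x :=
  mul_pos (C0_pos hα) (Real.exp_pos _)

lemma fd_integrable {α : ℝ} (hα : 0 < α) (θ : ℝ) : Integrable (fd α θ) :=
  ((integrable_exp_neg_abs_rpow hα).comp_sub_right θ).const_mul (C0 α)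

lemma mul_fd_integrable {α : ℝ} (hα : 0 < α) (θ : ℝ) :
    Integrable fun x => x * fd α θ x := by
  have h := (((integrable_mul_exp_neg_abs_rpow hα).comp_sub_right θ).const_mul (C0 α)).add
    ((fd_integrable hα θ).const_mul θ)
  refine h.congr (ae_of_all _ fun x => ?_)
  simp only [Pi.add_apply, fd]
  ring

lemma hasDerivAt_integral_Ioi {g : ℝ → ℝ} (hg : Continuous g) (hi : Integrable g) (S : ℝ) :
    HasDerivAt (fun t => ∫ x in Ioi t, g x) (-g S) S := by
  have h : (fun t => ∫ x in Ioi t, g x) = fun t => (∫ x in Ioi S, g x) - ∫ x in S..t, g x := by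
    funext t
    rw [← intervalIntegral.integral_Ioi_sub_Ioi' hi.integrableOn hi.integrableOn]
    ring
  rw [h]
  exact (hg.integral_hasStrictDerivAt S S).hasDerivAt.const_sub _

lemma hasDerivAt_Ptail {α : ℝ} (hα : 0 < α) (θ S : ℝ) :
    HasDerivAt (Ptail α θ) (-fd α θ S) S :=
  hasDerivAt_integral_Ioi (fd_continuous hα θ) (fd_integrable hα θ) S

lemma Ptail_strictAnti {α : ℝ} (hα : 0 < α) (θ : ℝ) : StrictAnti (Ptail α θ) :=
  strictAnti_of_hasDerivAt_neg (hasDerivAt_Ptail hα θ) fun x => neg_lt_zero.2 (fd_pos hα θ x)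

lemma Ptail_nonneg {α : ℝ} (hα : 0 < α) (θ S : ℝ) : 0 ≤ Ptail α θ S :=
  integral_nonneg fun x => (fd_pos hα θ x).le

lemma Ptail_pos {α : ℝ} (hα : 0 < α) (θ S : ℝ) : 0 < Ptail α θ S :=
  (Ptail_nonneg hα θ (S + 1)).trans_lt (Ptail_strictAnti hα θ (by linarith))

/-- The integrated tail `∫_S^∞ P_θ(x) dx`. -/
noncomputable def Gtail (α θ S : ℝ) : ℝ := ∫ x in Ioi S, Ptail α θ x

lemma tendsto_mul_Ptail {α : ℝ} (hα : 0 < α) (θ : ℝ) :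
    Tendsto (fun S => S * Ptail α θ S) atTop (𝓝 0) := by
  refine tendsto_of_tendsto_of_tendsto_of_le_of_le' tendsto_const_nhds
    (tendsto_integral_Ioi_zero (f := fun x => x * fd α θ x) (μ := volume) tendsto_id) ?_ ?_
  · filter_upwards [eventually_ge_atTop 0] with S hS
    exact mul_nonneg hS (Ptail_nonneg hα θ S)
  · refine Eventually.of_forall fun S => ?_
    rw [Ptail, ← integral_const_mul]
    exact setIntegral_mono_on ((fd_integrable hα θ).const_mul S).integrableOn
      (mul_fd_integrable hα θ).integrableOn measurableSet_Ioi fun x hx =>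
      mul_le_mul_of_nonneg_right (le_of_lt hx) (fd_pos hα θ x).le

lemma hasDerivAt_integral_mul_fd_sub {α : ℝ} (hα : 0 < α) (θ S : ℝ) :
    HasDerivAt (fun S => (∫ x in Ioi S, x * fd α θ x) - S * Ptail α θ S) (-Ptail α θ S) S := by
  refine ((hasDerivAt_integral_Ioi (g := fun x => x * fd α θ x)
    (continuous_id.mul (fd_continuous hα θ)) (mul_fd_integrable hα θ) S).sub
    ((hasDerivAt_id S).mul (hasDerivAt_Ptail hα θ S))).congr_deriv ?_
  simp only [id]
  ring

lemma integral_mul_fd_eq {α : ℝ} (hα : 0 < α) (θ S : ℝ) :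
    ∫ x in Ioi S, x * fd α θ x = S * Ptail α θ S + Gtail α θ S := by
  have h := integral_Ioi_of_hasDerivAt_of_nonpos' (a := S)
    (fun x _ => hasDerivAt_integral_mul_fd_sub hα θ x)
    (fun x _ => neg_nonpos.2 (Ptail_nonneg hα θ x))
    ((tendsto_integral_Ioi_zero tendsto_id).sub (tendsto_mul_Ptail hα θ))
  rw [integral_neg] at h
  unfold Gtail
  linarith

lemma hasDerivAt_Gtail {α : ℝ} (hα : 0 < α) (θ S : ℝ) :
    HasDerivAt (Gtail α θ) (-Ptail α θ S) S := by
  have h : Gtail α θ = fun S => (∫ x in Ioi S, x * fd α θ x) - S * Ptail α θ S := by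
    funext t
    rw [integral_mul_fd_eq hα]
    ring
  rw [h]
  exact hasDerivAt_integral_mul_fd_sub hα θ S

lemma Gtail_strictAnti {α : ℝ} (hα : 0 < α) (θ : ℝ) : StrictAnti (Gtail α θ) :=
  strictAnti_of_hasDerivAt_neg (hasDerivAt_Gtail hα θ) fun x => neg_lt_zero.2 (Ptail_pos hα θ x)

lemma Gtail_nonneg {α : ℝ} (hα : 0 < α) (θ S : ℝ) : 0 ≤ Gtail α θ S :=
  integral_nonneg fun x => Ptail_nonneg hα θ x

lemma integral_Ioi_comp_add (g : ℝ → ℝ) (S e : ℝ) :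
    ∫ x in Ioi S, g (x + e) = ∫ x in Ioi (S + e), g x := by
  have h := (measurePreserving_add_right volume e).setIntegral_preimage_emb
    (measurableEmbedding_addRight e) g (Ioi (S + e))
  simpa using h

lemma Ptail_sub {α : ℝ} (θ e S : ℝ) : Ptail α (θ - e) S = Ptail α θ (S + e) := by
  unfold Ptail
  rw [← integral_Ioi_comp_add]
  congr 1
  funext x
  simp only [fd]
  ring_nf

lemma Gtail_sub {α : ℝ} (θ e S : ℝ) : Gtail α (θ - e) S = Gtail α θ (S + e) := by
  unfold Gtail
  rw [← integral_Ioi_comp_add]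
  simp only [Ptail_sub]

lemma slope_bounds {g f : ℝ → ℝ} {a b : ℝ} (hab : a ≤ b) (hg : ∀ x, HasDerivAt g (-f x) x)
    (hf : AntitoneOn f (Icc a b)) :
    (b - a) * f b ≤ g a - g b ∧ g a - g b ≤ (b - a) * f a := by
  rcases hab.eq_or_lt with rfl | hlt
  · simp
  obtain ⟨c, hc, h⟩ := exists_hasDerivAt_eq_slope g (fun x => -f x) hlt
    (fun x _ => (hg x).continuousAt.continuousWithinAt) fun x _ => hg x
  have hpos : 0 < b - a := sub_pos.2 hlt
  rw [eq_div_iff hpos.ne'] at h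
  have h1 := hf ⟨le_rfl, hab⟩ ⟨hc.1.le, hc.2.le⟩ hc.1.le
  have h2 := hf ⟨hc.1.le, hc.2.le⟩ ⟨hab, le_rfl⟩ hc.2.le
  constructor <;> nlinarith

lemma fd_antitoneOn {α : ℝ} (hα : 0 < α) (θ : ℝ) : AntitoneOn (fd α θ) (Ici θ) := by
  intro x hx y hy hxy
  have hx' : 0 ≤ x - θ := sub_nonneg.2 hx
  have hy' : 0 ≤ y - θ := sub_nonneg.2 hy
  have := C0_pos hα
  unfold fd
  rw [abs_of_nonneg hx', abs_of_nonneg hy']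
  gcongr

lemma fd_le_Gtail {α : ℝ} (hα : 0 < α) {θ S : ℝ} (hS : θ ≤ S) :
    fd α θ (S + 2) ≤ Gtail α θ S := by
  have h1 := (slope_bounds (show S ≤ S + 1 by linarith) (hasDerivAt_Gtail hα θ)
    ((Ptail_strictAnti hα θ).antitone.antitoneOn _)).1
  have h2 := (slope_bounds (show S + 1 ≤ S + 2 by linarith) (hasDerivAt_Ptail hα θ)
    ((fd_antitoneOn hα θ).mono fun x hx => show θ ≤ x by linarith [hx.1])).1
  have h3 := Gtail_nonneg hα θ (S + 1)
  have h4 := Ptail_nonneg hα θ (S + 2)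
  linarith

lemma tendsto_rpow_mul_exp_neg {α : ℝ} (hα : 0 < α) (s : ℝ) :
    Tendsto (fun x : ℝ => x ^ s * Real.exp (-(x ^ α))) atTop (𝓝 0) := by
  refine ((tendsto_rpow_mul_exp_neg_mul_atTop_nhds_zero (s / α) 1 one_pos).comp
    (tendsto_rpow_atTop hα)).congr' ?_
  filter_upwards [eventually_ge_atTop 0] with x hx
  simp only [Function.comp, ← Real.rpow_mul hx, mul_div_cancel₀ s hα.ne']
  ring_nf

lemma tendsto_sub_const_atTop (θ : ℝ) : Tendsto (fun x : ℝ => x - θ) atTop atTop :=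
  tendsto_atTop_add_const_right _ (-θ) tendsto_id

lemma tendsto_mul_fd {α : ℝ} (hα : 0 < α) (θ : ℝ) :
    Tendsto (fun S => S * fd α θ S) atTop (𝓝 0) := by
  have h1 := ((tendsto_rpow_mul_exp_neg hα 1).comp (tendsto_sub_const_atTop θ)).const_mul (C0 α)
  have h2 := ((tendsto_rpow_mul_exp_neg hα 0).comp (tendsto_sub_const_atTop θ)).const_mul
    (θ * C0 α)
  have h := h1.add h2
  simp only [mul_zero, add_zero] at h
  refine h.congr' ?_
  filter_upwards [eventually_ge_atTop θ] with x hx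
  simp only [Function.comp, fd, Real.rpow_one, Real.rpow_zero, abs_of_nonneg (sub_nonneg.2 hx)]
  ring

lemma tendsto_mul_sub_rpow {α : ℝ} (hα : 0 < α) (θ : ℝ) :
    Tendsto (fun S => S * (S - θ) ^ (α - 1)) atTop atTop := by
  have hsub := tendsto_sub_const_atTop θ
  have h1 : Tendsto (fun S : ℝ => 1 + θ / (S - θ)) atTop (𝓝 (1 + 0)) :=
    tendsto_const_nhds.add (tendsto_const_nhds.div_atTop hsub)
  rw [add_zero] at h1
  refine (((tendsto_rpow_atTop hα).comp hsub).atTop_mul_pos one_pos h1).congr' ?_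
  filter_upwards [eventually_gt_atTop θ] with x hx
  have hx' : 0 < x - θ := sub_pos.2 hx
  simp only [Function.comp]
  rw [Real.rpow_sub_one hx'.ne']
  field_simp
  ring

lemma hasDerivAt_fd {α θ S : ℝ} (hS : θ < S) :
    HasDerivAt (fd α θ) (-(α * (S - θ) ^ (α - 1)) * fd α θ S) S := by
  have hS' : 0 < S - θ := sub_pos.2 hS
  have h : HasDerivAt (fun x => C0 α * Real.exp (-((x - θ) ^ α)))
      (-(α * (S - θ) ^ (α - 1)) * fd α θ S) S := by
    refine ((((hasDerivAt_id S).sub_const θ).rpow_const (p := α)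
      (Or.inl hS'.ne')).neg.exp.const_mul (C0 α)).congr_deriv ?_
    simp only [fd, id, abs_of_pos hS', Pi.neg_apply]
    ring
  refine h.congr_of_eventuallyEq ?_
  filter_upwards [lt_mem_nhds hS] with x hx
  simp only [fd, abs_of_pos (sub_pos.2 hx)]

lemma tendsto_Ptail_div_mul_fd {α : ℝ} (hα : 0 < α) (θ : ℝ) :
    Tendsto (fun S => Ptail α θ S / (S * fd α θ S)) atTop (𝓝 0) := by
  have hlim : Tendsto (fun S : ℝ => α * (S * (S - θ) ^ (α - 1)) - 1) atTop atTop :=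
    tendsto_atTop_add_const_right _ (-1) ((tendsto_mul_sub_rpow hα θ).const_mul_atTop hα)
  have hg : ∀ S, 1 * fd α θ S + S * (-(α * (S - θ) ^ (α - 1)) * fd α θ S)
      = -((α * (S * (S - θ) ^ (α - 1)) - 1) * fd α θ S) := fun S => by ring
  refine HasDerivAt.lhopital_zero_atTop (f' := fun S => -fd α θ S)
    (g' := fun S => 1 * fd α θ S + S * (-(α * (S - θ) ^ (α - 1)) * fd α θ S))
    (Eventually.of_forall (hasDerivAt_Ptail hα θ)) ?_ ?_
    (tendsto_integral_Ioi_zero tendsto_id) (tendsto_mul_fd hα θ) ?_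
  · filter_upwards [eventually_gt_atTop θ] with x hx
    exact (hasDerivAt_id x).mul (hasDerivAt_fd hx)
  · filter_upwards [hlim.eventually_gt_atTop 0] with x hx
    rw [hg]
    exact neg_ne_zero.2 (mul_pos hx (fd_pos hα θ x)).ne'
  · refine hlim.inv_tendsto_atTop.congr fun x => ?_
    have := (fd_pos hα θ x).ne'
    rw [hg, neg_div_neg_eq, Pi.inv_apply, div_mul_cancel_right₀ this]

lemma tendsto_Gtail_div_mul_Ptail {α : ℝ} (hα : 0 < α) (θ : ℝ) :
    Tendsto (fun S => Gtail α θ S / (S * Ptail α θ S)) atTop (𝓝 0) := by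
  have h0 := tendsto_Ptail_div_mul_fd hα θ
  have hden : ∀ᶠ S in atTop, 0 < S ∧ Ptail α θ S / (S * fd α θ S) < 1 :=
    (eventually_gt_atTop 0).and (h0.eventually_lt_const one_pos)
  refine HasDerivAt.lhopital_zero_atTop (f' := fun S => -Ptail α θ S)
    (g' := fun S => 1 * Ptail α θ S + S * -fd α θ S)
    (Eventually.of_forall (hasDerivAt_Gtail hα θ))
    (Eventually.of_forall fun x => (hasDerivAt_id x).mul (hasDerivAt_Ptail hα θ x)) ?_
    (tendsto_integral_Ioi_zero tendsto_id) (tendsto_mul_Ptail hα θ) ?_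
  · filter_upwards [hden] with x ⟨hx, hx1⟩
    rw [div_lt_one (mul_pos hx (fd_pos hα θ x))] at hx1
    linarith
  · have h1 := h0.div (tendsto_const_nhds.sub h0) (by norm_num : (1 : ℝ) - 0 ≠ 0)
    rw [zero_div] at h1
    refine h1.congr' ?_
    filter_upwards [hden] with x ⟨hx, hx1⟩
    have hf := mul_pos hx (fd_pos hα θ x)
    rw [div_lt_one hf] at hx1
    have h2 : x * fd α θ x - Ptail α θ x ≠ 0 := by linarith
    rw [Pi.div_apply, one_sub_div hf.ne', div_div_div_cancel_right₀ hf.ne', ← neg_div_neg_eq]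
    congr 1
    ring

lemma Vfun_eq {α : ℝ} (hα : 0 < α) (θ γ S : ℝ) :
    Vfun α θ γ S = (S * Ptail α θ S + Gtail α θ S) / ((1 - γ) + γ * Ptail α θ S) := by
  rw [Vfun, muTail, div_mul_cancel₀ _ (Ptail_pos hα θ S).ne', integral_mul_fd_eq hα]

/-- Bounds on the relative regret of a threshold `T` below the optimal threshold `S`. -/
lemma regret_bounds {α : ℝ} (hα : 0 < α) {θ γ S T e : ℝ} (hγ : γ ∈ Ioo (0 : ℝ) 1)
    (hS : 0 < S) (hST : ((1 - γ) / γ) * S = Gtail α θ S) (hT : 0 < T) (he : S - e ≤ T)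
    (hTS : T ≤ S) :
    0 ≤ 1 - Vfun α θ γ T / Vfun α θ γ S ∧
      1 - Vfun α θ γ T / Vfun α θ γ S ≤ e / S + Gtail α θ S / (S * Ptail α θ S) := by
  obtain ⟨hγ0, hγ1⟩ := hγ
  have hPS := Ptail_pos hα θ S
  have hPT := Ptail_pos hα θ T
  have hP : Ptail α θ S ≤ Ptail α θ T := (Ptail_strictAnti hα θ).antitone hTS
  have hconv := (slope_bounds hTS (hasDerivAt_Gtail hα θ)
    ((Ptail_strictAnti hα θ).antitone.antitoneOn _)).2
  have hGT := Gtail_nonneg hα θ T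
  obtain ⟨δ, hδ⟩ : ∃ δ, δ = (1 - γ) / γ := ⟨_, rfl⟩
  have hδ0 : 0 < δ := hδ ▸ div_pos (by linarith) hγ0
  have h1γ : 1 - γ = γ * δ := by rw [hδ]; field_simp
  rw [← hδ] at hST
  have hratio : Vfun α θ γ T / Vfun α θ γ S =
      (T * Ptail α θ T + Gtail α θ T) / (S * (δ + Ptail α θ T)) := by
    rw [Vfun_eq hα, Vfun_eq hα, ← hST, h1γ]
    have : 0 < δ + Ptail α θ S := by positivity
    have : 0 < δ + Ptail α θ T := by positivity
    rw [← mul_add, ← mul_add, mul_comm δ S, ← mul_add, add_comm (Ptail α θ S) δ]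
    field_simp
  have hD : 0 < S * (δ + Ptail α θ T) := by positivity
  have hq : Gtail α θ S / (S * Ptail α θ S) = δ / Ptail α θ S := by
    rw [← hST]
    field_simp
  rw [hratio, hq]
  constructor
  · rw [sub_nonneg, div_le_one hD]
    nlinarith
  · have hmono : δ / (δ + Ptail α θ T) ≤ δ / Ptail α θ S :=
      div_le_div_of_nonneg_left hδ0.le hPS (by linarith)
    have hid : 1 - (T * Ptail α θ T + Gtail α θ T) / (S * (δ + Ptail α θ T)) =
        ((S - T) * Ptail α θ T - Gtail α θ T) / (S * (δ + Ptail α θ T)) +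
          δ / (δ + Ptail α θ T) := by
      have : 0 < δ + Ptail α θ T := by positivity
      field_simp
      ring
    have hfirst : ((S - T) * Ptail α θ T - Gtail α θ T) / (S * (δ + Ptail α θ T)) ≤ e / S := by
      rw [div_le_div_iff₀ hD hS]
      have h1 : (S - T) * Ptail α θ T ≤ e * Ptail α θ T := by nlinarith
      have h2 : 0 ≤ e * δ := mul_nonneg (by linarith) hδ0.le
      nlinarith
    linarith

lemma tendsto_log_one_div_one_sub :
    Tendsto (fun γ : ℝ => Real.log (1 / (1 - γ))) (𝓝[<] (1 : ℝ)) atTop := by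
  have h : Tendsto (fun γ : ℝ => 1 - γ) (𝓝[<] (1 : ℝ)) (𝓝[>] 0) := by
    refine tendsto_nhdsWithin_iff.2 ⟨?_, ?_⟩
    · have : Tendsto (fun γ : ℝ => 1 - γ) (𝓝 1) (𝓝 (1 - 1)) :=
        (continuous_const.sub continuous_id).tendsto 1
      rw [sub_self] at this
      exact this.mono_left nhdsWithin_le_nhds
    · filter_upwards [self_mem_nhdsWithin] with x hx
      exact sub_pos.2 (mem_Iio.1 hx)
  simp only [one_div]
  exact Real.tendsto_log_atTop.comp (tendsto_inv_nhdsGT_zero.comp h)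

/-- The optimal threshold grows at least like `(log (1/(1-γ)))^{1/α}`. -/
lemma eventually_le_threshold {α : ℝ} (hα : 0 < α) (θ : ℝ) {S : ℝ → ℝ}
    (hS : ∀ γ ∈ Ioo (0 : ℝ) 1, ((1 - γ) / γ) * S γ = Gtail α θ (S γ)) :
    ∀ᶠ γ in 𝓝[<] (1 : ℝ), (Real.log (1 / (1 - γ)) / 2) ^ (1 / α) / 2 ≤ S γ := by
  have hM : Tendsto (fun γ : ℝ => Real.log (1 / (1 - γ)) / 2) (𝓝[<] (1 : ℝ)) atTop :=
    tendsto_log_one_div_one_sub.atTop_div_const two_pos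
  have hy : Tendsto (fun γ : ℝ => (Real.log (1 / (1 - γ)) / 2) ^ (1 / α) / 2)
      (𝓝[<] (1 : ℝ)) atTop :=
    ((tendsto_rpow_atTop (by positivity)).comp hM).atTop_div_const two_pos
  have hsmall := ((tendsto_rpow_mul_exp_neg_mul_atTop_nhds_zero (1 / α) 1 one_pos).comp
    hM).eventually_lt_const (C0_pos hα)
  have hγ : ∀ᶠ γ in 𝓝[<] (1 : ℝ), γ ∈ Ioo (1 / 2 : ℝ) 1 :=
    Ioo_mem_nhdsLT (by norm_num)
  filter_upwards [hγ, hM.eventually_gt_atTop 0, hy.eventually_ge_atTop (2 - θ),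
    hy.eventually_ge_atTop θ, hsmall] with γ hγ hM0 hy1 hy2 hsmall
  obtain ⟨M, hMdef⟩ : ∃ M, M = Real.log (1 / (1 - γ)) / 2 := ⟨_, rfl⟩
  simp only [Function.comp, ← hMdef] at hM0 hy1 hy2 hsmall ⊢
  by_contra! hlt
  have h1γ : 0 < 1 - γ := sub_pos.2 hγ.2
  have hγ0 : 0 < γ := by linarith [hγ.1]
  have hexp : 1 - γ = Real.exp (-M) * Real.exp (-M) := by
    rw [← Real.exp_add, ← neg_add, ← two_mul, hMdef, mul_div_cancel₀ _ two_ne_zero, one_div,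
      Real.log_inv, neg_neg, Real.exp_log h1γ]
  have hGlow := fd_le_Gtail hα hy2
  have hGup := Gtail_strictAnti hα θ hlt
  rw [← hS γ ⟨hγ0, hγ.2⟩] at hGup
  have hδ : (1 - γ) / γ ≤ 2 * (1 - γ) := by
    rw [div_le_iff₀ hγ0]
    nlinarith [hγ.1]
  have hδ0 : 0 < (1 - γ) / γ := div_pos h1γ hγ0
  have hfd : C0 α * Real.exp (-M) ≤ fd α θ (M ^ (1 / α) / 2 + 2) := by
    have := C0_pos hα
    have h0 : 0 ≤ M ^ (1 / α) / 2 + 2 - θ := by linarith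
    unfold fd
    rw [abs_of_nonneg h0]
    gcongr
    calc (M ^ (1 / α) / 2 + 2 - θ) ^ α ≤ (M ^ (1 / α)) ^ α := by
          gcongr
          linarith
      _ = M := by rw [← Real.rpow_mul hM0.le, one_div_mul_cancel hα.ne', Real.rpow_one]
  have hy0 : 0 < M ^ (1 / α) := Real.rpow_pos_of_pos hM0 _
  have hchain : C0 α * Real.exp (-M) < M ^ (1 / α) * Real.exp (-M) * Real.exp (-M) := by
    calc C0 α * Real.exp (-M) < (1 - γ) / γ * S γ := by linarith
      _ ≤ (1 - γ) / γ * (M ^ (1 / α) / 2) := by gcongr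
      _ ≤ 2 * (1 - γ) * (M ^ (1 / α) / 2) := by gcongr
      _ = M ^ (1 / α) * Real.exp (-M) * Real.exp (-M) := by rw [hexp]; ring
  have := lt_of_mul_lt_mul_right hchain (Real.exp_pos _).le
  rw [neg_one_mul] at hsmall
  linarith

/-- Robustness of relative regret to underestimation of the location parameter
(Theorem `thmnegative`). -/
theorem stmt_16 (α : ℝ) (hα : 1/2 ≤ α) (θ : ℝ)
    (Sstar : ℝ → ℝ → ℝ)
    (hS : ∀ ϑ : ℝ, ∀ γ ∈ Set.Ioo (0:ℝ) 1,
      0 < Sstar ϑ γ ∧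
      ((1-γ)/γ) * Sstar ϑ γ = (∫ x in Set.Ioi (Sstar ϑ γ), Ptail α ϑ x) ∧
      ∀ S, 0 < S → ((1-γ)/γ) * S = (∫ x in Set.Ioi S, Ptail α ϑ x) → S = Sstar ϑ γ)
    (ε : ℝ → ℝ) (hε0 : ∀ γ, 0 ≤ ε γ)
    (hε : Tendsto (fun γ => ε γ / (Real.log (1/(1-γ))) ^ (1/α)) (𝓝[<] (1:ℝ)) (𝓝 0)) :
    Tendsto (fun γ => 1 - Vfun α θ γ (Sstar (θ - ε γ) γ) / Vfun α θ γ (Sstar θ γ))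
      (𝓝[<] (1:ℝ)) (𝓝 0) := by
  have hα0 : 0 < α := by linarith
  have hfix : ∀ ϑ : ℝ, ∀ γ ∈ Ioo (0 : ℝ) 1,
      ((1 - γ) / γ) * Sstar ϑ γ = Gtail α ϑ (Sstar ϑ γ) := fun ϑ γ hγ => (hS ϑ γ hγ).2.1
  have hlow := eventually_le_threshold hα0 θ (hfix θ)
  have hStop : Tendsto (Sstar θ) (𝓝[<] (1 : ℝ)) atTop :=
    tendsto_atTop_mono' _ hlow <| ((tendsto_rpow_atTop (by positivity)).comp
      (tendsto_log_one_div_one_sub.atTop_div_const two_pos)).atTop_div_const two_pos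
  have hεS : Tendsto (fun γ => ε γ / Sstar θ γ) (𝓝[<] (1 : ℝ)) (𝓝 0) := by
    have hlim := hε.const_mul (2 * 2 ^ (1 / α))
    rw [mul_zero] at hlim
    refine tendsto_of_tendsto_of_tendsto_of_le_of_le' tendsto_const_nhds hlim ?_ ?_
    · filter_upwards [hStop.eventually_gt_atTop 0] with γ hγ
      exact div_nonneg (hε0 γ) hγ.le
    · filter_upwards [hlow, tendsto_log_one_div_one_sub.eventually_gt_atTop 0] with γ hγ hL
      have hLα := Real.rpow_pos_of_pos hL (1 / α)
      have h2α := Real.rpow_pos_of_pos two_pos (1 / α)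
      rw [Real.div_rpow hL.le two_pos.le] at hγ
      calc ε γ / Sstar θ γ ≤ ε γ / (Real.log (1 / (1 - γ)) ^ (1 / α) / 2 ^ (1 / α) / 2) :=
            div_le_div_of_nonneg_left (hε0 γ) (by positivity) hγ
        _ = _ := by field_simp
  have hupper := hεS.add ((tendsto_Gtail_div_mul_Ptail hα0 θ).comp hStop)
  rw [add_zero] at hupper
  have hbounds : ∀ᶠ γ in 𝓝[<] (1 : ℝ),
      0 ≤ 1 - Vfun α θ γ (Sstar (θ - ε γ) γ) / Vfun α θ γ (Sstar θ γ) ∧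
      1 - Vfun α θ γ (Sstar (θ - ε γ) γ) / Vfun α θ γ (Sstar θ γ) ≤ ε γ / Sstar θ γ +
        Gtail α θ (Sstar θ γ) / (Sstar θ γ * Ptail α θ (Sstar θ γ)) := by
    filter_upwards [Ioo_mem_nhdsLT (zero_lt_one' ℝ)] with γ hγ
    have hδ0 : 0 < (1 - γ) / γ := div_pos (sub_pos.2 hγ.2) hγ.1
    have hfixS := hfix θ γ hγ
    have hfixT := hfix (θ - ε γ) γ hγ
    rw [Gtail_sub] at hfixT
    have hTS : Sstar (θ - ε γ) γ ≤ Sstar θ γ := by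
      by_contra! hlt
      have h1 := Gtail_strictAnti hα0 θ (hlt.trans_le (le_add_of_nonneg_right (hε0 γ)))
      have h2 := mul_lt_mul_of_pos_left hlt hδ0
      linarith
    have hST : Sstar θ γ ≤ Sstar (θ - ε γ) γ + ε γ := by
      rw [← (Gtail_strictAnti hα0 θ).le_iff_ge, ← hfixS, ← hfixT]
      gcongr
    exact regret_bounds hα0 hγ (hS θ γ hγ).1 hfixS (hS _ γ hγ).1 (by linarith) hTS
  exact tendsto_of_tendsto_of_tendsto_of_le_of_le' tendsto_const_nhds hupper
    (hbounds.mono fun _ h => h.1) (hbounds.mono fun _ h => h.2)
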